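/- Every rule generated by the lpopt algorithm from a rule π using a tree decomposition of width k contains at most k+1 distinct variables; consequently the number of ground instances of each generated rule over a domain C is at most |C|^(k+1). -/

import Mathlib

/-! Basic syntax of (non-ground) logic programs: terms, atoms, rules,
grounding and the stable-model (answer-set) semantics. -/

/-- Variables. -/
abbrev Var : Type := ℕ
/-- Constants. -/
abbrev Cst : Type := ℕ

/-- A term is a variable or a constant. -/
inductive Trm : Type where
  | var : Var → Trm
  | const : Cst → Trm
deriving DecidableEq

namespace Trm

def vars : Trm → Finset Var
  | var x => {x}
  | const _ => ∅

def consts : Trm → Finset Cst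
  | var _ => ∅
  | const c => {c}

/-- Apply a (ground) substitution to a term. -/
def subst (s : Var → Cst) : Trm → Trm
  | var x => const (s x)
  | const c => const c

/-- Evaluate a term to a constant under a ground substitution. -/
def eval (s : Var → Cst) : Trm → Cst
  | var x => s x
  | const c => c

end Trm

/-- The set of variables of a list of terms. -/
def trmsVars (l : List Trm) : Finset Var := l.foldr (fun t s => t.vars ∪ s) ∅

/-- The set of constants of a list of terms. -/
def trmsConsts (l : List Trm) : Finset Cst := l.foldr (fun t s => t.consts ∪ s) ∅

/-- An atom over the schema (set of predicate symbols) `P`. -/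
structure Atm (P : Type) where
  pred : P
  args : List Trm
deriving DecidableEq

namespace Atm

variable {P : Type}

def vars (a : Atm P) : Finset Var := trmsVars a.args

def consts (a : Atm P) : Finset Cst := trmsConsts a.args

def subst (s : Var → Cst) (a : Atm P) : Atm P := ⟨a.pred, a.args.map (Trm.subst s)⟩

end Atm

/-- A logic programming rule: a disjunctive head, a positive body and a
negative body (sets of atoms; the negative body atoms are implicitly negated). -/
structure Rule (P : Type) where
  head : Finset (Atm P)
  pos : Finset (Atm P)
  neg : Finset (Atm P)
deriving DecidableEq

namespace Rule

variable {P : Type} [DecidableEq P]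

def atoms (r : Rule P) : Finset (Atm P) := r.head ∪ r.pos ∪ r.neg

def vars (r : Rule P) : Finset Var := r.atoms.sup Atm.vars

def consts (r : Rule P) : Finset Cst := r.atoms.sup Atm.consts

def headVars (r : Rule P) : Finset Var := r.head.sup Atm.vars

/-- A rule is safe if every variable occurs in the positive body. -/
def Safe (r : Rule P) : Prop := r.vars ⊆ r.pos.sup Atm.vars

def subst (s : Var → Cst) (r : Rule P) : Rule P :=
  ⟨r.head.image (Atm.subst s), r.pos.image (Atm.subst s), r.neg.image (Atm.subst s)⟩

end Rule

section Semantics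

variable {P : Type} [DecidableEq P]

/-- All ground instances of a rule w.r.t. a domain `D` of constants. -/
def groundInstances (D : Finset Cst) (r : Rule P) : Set (Rule P) :=
  { r' | ∃ s : Var → Cst, (∀ x, s x ∈ D) ∧ r' = r.subst s }

/-- The active domain of a program: all constants occurring in it. -/
def adom (Pgm : Finset (Rule P)) : Finset Cst := Pgm.sup Rule.consts

/-- The grounding of a program w.r.t. an explicit domain. -/
def groundProgD (D : Finset Cst) (Pgm : Finset (Rule P)) : Set (Rule P) :=
  ⋃ r ∈ Pgm, groundInstances D r

/-- The grounding of a program (w.r.t. its active domain). -/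
def groundProg (Pgm : Finset (Rule P)) : Set (Rule P) := groundProgD (adom Pgm) Pgm

/-- An interpretation `I` satisfies a ground rule. -/
def satisfies (I : Set (Atm P)) (r : Rule P) : Prop :=
  ((r.pos : Set (Atm P)) ⊆ I ∧ ∀ a ∈ r.neg, a ∉ I) → ∃ a ∈ r.head, a ∈ I

/-- `I` is a (classical) model of a set of ground rules. -/
def isModel (I : Set (Atm P)) (Q : Set (Rule P)) : Prop := ∀ r ∈ Q, satisfies I r

/-- The Gelfond-Lifschitz reduct of a ground program w.r.t. `I`. -/
def reduct (Q : Set (Rule P)) (I : Set (Atm P)) : Set (Rule P) :=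
  { r' | ∃ r ∈ Q, (∀ a ∈ r.neg, a ∉ I) ∧ r' = ⟨r.head, r.pos, ∅⟩ }

/-- `I` is a stable model (answer set) of a set of ground rules. -/
def isStable (I : Set (Atm P)) (Q : Set (Rule P)) : Prop :=
  isModel I (reduct Q I) ∧ ∀ J, J ⊂ I → ¬ isModel J (reduct Q I)

/-- The answer sets of a non-ground program. -/
def answerSets (Pgm : Finset (Rule P)) : Set (Set (Atm P)) :=
  { I | isStable I (groundProg Pgm) }

/-- The answer sets of a non-ground program, grounding over an explicit domain. -/
def answerSetsD (D : Finset Cst) (Pgm : Finset (Rule P)) : Set (Set (Atm P)) :=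
  { I | isStable I (groundProgD D Pgm) }

end Semantics
/-! Rooted trees and tree decompositions. -/

/-- A rooted tree on the node type `ι`, given by a parent function:
the root is its own parent, and every node reaches the root by
iterating the parent function. -/
structure RTree (ι : Type) where
  root : ι
  parent : ι → ι
  parent_root : parent root = root
  rootReach : ∀ n, ∃ k, parent^[k] n = root

namespace RTree

variable {ι : Type}

/-- `a` is an ancestor of `n` (possibly `a = n`). -/
def Anc (T : RTree ι) (a n : ι) : Prop := ∃ k, T.parent^[k] n = a

/-- `s` lies on the (unique) path between `n` and `m`: it is an ancestor of
one of them, and every common ancestor of `n` and `m` is an ancestor of `s`. -/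
def OnPath (T : RTree ι) (s n m : ι) : Prop :=
  (T.Anc s n ∨ T.Anc s m) ∧ ∀ a, T.Anc a n → T.Anc a m → T.Anc a s

end RTree

/-- A (rooted) tree decomposition of the graph `G`, covering the (finite)
vertex set `VS`: every vertex of `VS` occurs in some bag, every edge of `G`
is covered by some bag, and the bags containing a fixed vertex are connected
(closed under paths) in the tree. -/
structure TreeDec (ι : Type) {α : Type} (G : SimpleGraph α) (VS : Finset α) where
  t : RTree ι
  bag : ι → Finset α
  covers_vertex : ∀ v ∈ VS, ∃ n, v ∈ bag n
  covers_edge : ∀ v w, G.Adj v w → ∃ n, v ∈ bag n ∧ w ∈ bag n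
  connected : ∀ v, ∀ n m s : ι, v ∈ bag n → v ∈ bag m → t.OnPath s n m → v ∈ bag s

/-- The decomposition has width (at most) `k`: all bags have ≤ k+1 elements. -/
def TreeDec.HasWidth {ι α : Type} {G : SimpleGraph α} {VS : Finset α}
    (td : TreeDec ι G VS) (k : ℕ) : Prop :=
  ∀ n, (td.bag n).card ≤ k + 1

/-- The width of a tree decomposition: maximal bag size minus one. -/
def TreeDec.width {ι α : Type} [Fintype ι] {G : SimpleGraph α} {VS : Finset α}
    (td : TreeDec ι G VS) : ℕ :=
  (Finset.univ.sup fun n => (td.bag n).card) - 1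
/-- The Gaifman graph of a rule: vertices are the variables of the rule,
with an edge between two (distinct) variables iff they occur together in the
head or in a body atom of the rule. -/
def gaifman {P : Type} [DecidableEq P] (r : Rule P) : SimpleGraph Var :=
  SimpleGraph.fromRel fun x y =>
    (x ∈ r.headVars ∧ y ∈ r.headVars) ∨ ∃ a ∈ r.pos ∪ r.neg, x ∈ a.vars ∧ y ∈ a.vars
/-! The lpopt rule decomposition algorithm. -/

/-- Predicates of the program produced by lpopt: the original predicates,
a fresh temporary predicate `temp r n` for each rule `r` and decomposition
node `n`, and a fresh domain predicate `dom r x` for each rule `r` and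
variable `x`. -/
inductive LP (P ι : Type) where
  | base : P → LP P ι
  | temp : Rule P → ι → LP P ι
  | dom : Rule P → Var → LP P ι
deriving DecidableEq

/-- Lift an atom over `P` to an atom over the extended schema. -/
def Atm.lift {P ι : Type} (a : Atm P) : Atm (LP P ι) := ⟨LP.base a.pred, a.args⟩

/-- The list of variables of a finite set of variables, as terms. -/
def varsTerms (S : Finset Var) : List Trm := (S.sort (· ≤ ·)).map Trm.var

section Lpopt

variable {P ι : Type} [DecidableEq P] [DecidableEq ι] [Fintype ι]

/-- The temporary atom `temp_n(Y_n)` for node `n`, where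
`Y_n = χ(n) ∩ χ(parent n)`. -/
def tempAtm (r : Rule P) (td : TreeDec ι (gaifman r) r.vars) (n : ι) : Atm (LP P ι) :=
  ⟨LP.temp r n, varsTerms (td.bag n ∩ td.bag (td.t.parent n))⟩

/-- The domain atom `dom_x(x)`. -/
def domAtm (r : Rule P) (x : Var) : Atm (LP P ι) := ⟨LP.dom r x, [Trm.var x]⟩

/-- Variable `x` needs a domain predicate in the rule generated for a node with
bag `B`: it occurs in a negative body atom with variables inside `B`, but in no
positive body atom with variables inside `B`. -/
def needsDomAt (r : Rule P) (B : Finset Var) (x : Var) : Prop :=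
  (∃ a ∈ r.neg, a.vars ⊆ B ∧ x ∈ a.vars) ∧ ¬ ∃ b ∈ r.pos, b.vars ⊆ B ∧ x ∈ b.vars

open scoped Classical in
/-- Step 2 of lpopt: the rule generated for decomposition node `n`.  Its head
is the original head at the root and the temporary atom `temp_n(Y_n)`
otherwise; its body consists of all literals of the original rule whose
variables are inside the bag of `n`, the temporary atoms of the children of
`n`, and the required domain atoms. -/
noncomputable def genRule (r : Rule P) (td : TreeDec ι (gaifman r) r.vars) (n : ι) :
    Rule (LP P ι) where
  head := if n = td.t.root then r.head.image Atm.lift else {tempAtm r td n}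
  pos :=
    ((r.pos.filter fun a => a.vars ⊆ td.bag n).image Atm.lift)
    ∪ ((Finset.univ.filter fun m => td.t.parent m = n ∧ m ≠ td.t.root).image
        fun m => tempAtm r td m)
    ∪ ((r.vars.filter fun x => needsDomAt r (td.bag n) x).image fun x => domAtm r x)
  neg := (r.neg.filter fun a => a.vars ⊆ td.bag n).image Atm.lift

open scoped Classical in
/-- The variables of `r` for which a domain predicate is needed somewhere. -/
noncomputable def domVars (r : Rule P) (td : TreeDec ι (gaifman r) r.vars) : Finset Var :=
  r.vars.filter fun x => ∃ n : ι, needsDomAt r (td.bag n) x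

/-- Step 3 of lpopt: the domain rule `dom_x(x) ← a` for a chosen positive body
atom `a = dc x`. -/
def domRuleFor (r : Rule P) (dc : Var → Atm P) (x : Var) : Rule (LP P ι) :=
  ⟨{domAtm r x}, {Atm.lift (dc x)}, ∅⟩

/-- The set of rules lpopt produces from the single rule `r`. -/
noncomputable def lpoptRule (r : Rule P) (td : TreeDec ι (gaifman r) r.vars)
    (dc : Var → Atm P) : Finset (Rule (LP P ι)) :=
  (Finset.univ.image fun n => genRule r td n)
  ∪ ((domVars r td).image fun x => domRuleFor r dc x)

/-- The program lpopt produces from the program `Pgm`, given for every rule a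
tree decomposition of its Gaifman graph and a choice of atoms generating the
domain predicates. -/
noncomputable def lpoptProg (Pgm : Finset (Rule P))
    (td : (r : Rule P) → TreeDec ι (gaifman r) r.vars)
    (dc : Rule P → Var → Atm P) : Finset (Rule (LP P ι)) :=
  Pgm.biUnion fun r => lpoptRule r (td r) (dc r)

/-- Remove all atoms over the fresh (temporary and domain) predicates from an
interpretation, keeping the atoms over the original predicates. -/
def strip (I : Set (Atm (LP P ι))) : Set (Atm P) := { a | Atm.lift a ∈ I }

end Lpopt

theorem mem_trmsVars {x : Var} {l : List Trm} : x ∈ trmsVars l ↔ ∃ t ∈ l, x ∈ t.vars := by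
  induction l with
  | nil => simp [trmsVars]
  | cons t l ih =>
    rw [show trmsVars (t :: l) = t.vars ∪ trmsVars l from rfl, Finset.mem_union, ih]
    simp

theorem trmsVars_varsTerms (S : Finset Var) : trmsVars (varsTerms S) = S := by
  ext x
  simp [mem_trmsVars, varsTerms, Trm.vars]

theorem Trm.subst_congr {s s' : Var → Cst} {t : Trm} (h : ∀ x ∈ t.vars, s x = s' x) :
    t.subst s = t.subst s' := by
  cases t with
  | var x => simp [Trm.subst, h x (by simp [Trm.vars])]
  | const c => rfl

theorem Atm.subst_congr {P : Type} {s s' : Var → Cst} {a : Atm P}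
    (h : ∀ x ∈ a.vars, s x = s' x) : a.subst s = a.subst s' := by
  simp only [Atm.subst, Atm.mk.injEq, true_and]
  exact List.map_congr_left fun t ht =>
    Trm.subst_congr fun x hx => h x (mem_trmsVars.2 ⟨t, ht, hx⟩)

theorem Rule.subst_congr {P : Type} [DecidableEq P] {s s' : Var → Cst} {r : Rule P}
    (h : ∀ x ∈ r.vars, s x = s' x) : r.subst s = r.subst s' := by
  have key : ∀ a ∈ r.atoms, a.subst s = a.subst s' := fun a ha =>
    Atm.subst_congr fun x hx => h x (Finset.le_sup (f := Atm.vars) ha hx)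
  simp only [Rule.subst, Rule.mk.injEq]
  refine ⟨Finset.image_congr ?_, Finset.image_congr ?_, Finset.image_congr ?_⟩ <;>
    exact fun a ha => key a (by simp_all [Rule.atoms])

/-- A rule has at most `|C| ^ |vars|` ground instances over `C`. -/
theorem ncard_groundInstances_le {P : Type} [DecidableEq P] (C : Finset Cst) (r : Rule P) :
    (groundInstances C r).ncard ≤ C.card ^ r.vars.card := by
  rcases C.eq_empty_or_nonempty with rfl | ⟨c, hc⟩
  · simp [groundInstances]
  · let g : (r.vars → C) → Rule P := fun f =>
      r.subst fun x => if hx : x ∈ r.vars then f ⟨x, hx⟩ else c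
    have hsub : groundInstances C r ⊆ Set.range g := by
      rintro _ ⟨s, hs, rfl⟩
      exact ⟨fun x => ⟨s x, hs x⟩, Rule.subst_congr fun x hx => by simp [hx]⟩
    calc (groundInstances C r).ncard ≤ (Set.range g).ncard :=
          Set.ncard_le_ncard hsub (Set.finite_range g)
      _ ≤ Nat.card (r.vars → C) := by
          rw [← Set.image_univ, ← Set.ncard_univ]
          exact Set.ncard_image_le Set.finite_univ
      _ = C.card ^ r.vars.card := by simp

/-- If the number of variables is at most `d`, there are at most `|C| ^ d` ground instances. -/
theorem ncard_groundInstances_le_of_card_vars_le {P : Type} [DecidableEq P] (C : Finset Cst)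
    {r : Rule P} {d : ℕ} (h : r.vars.card ≤ d) :
    (groundInstances C r).ncard ≤ C.card ^ d := by
  rcases C.eq_empty_or_nonempty with rfl | hC
  · simp [groundInstances]
  · exact (ncard_groundInstances_le C r).trans (Nat.pow_le_pow_right hC.card_pos h)

theorem vars_tempAtm {P ι : Type} [DecidableEq P] (r : Rule P)
    (td : TreeDec ι (gaifman r) r.vars) (n : ι) :
    (tempAtm r td n).vars = td.bag n ∩ td.bag (td.t.parent n) :=
  trmsVars_varsTerms _

/-- All variables of the rule generated for a node lie in the bag of that node. -/
theorem vars_genRule_subset_bag {P ι : Type} [DecidableEq P] [DecidableEq ι] [Fintype ι]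
    (r : Rule P) (td : TreeDec ι (gaifman r) r.vars)
    (hroot : r.headVars ⊆ td.bag td.t.root) (n : ι) :
    (genRule r td n).vars ⊆ td.bag n := by
  refine Finset.sup_le fun a ha => ?_
  simp only [Rule.atoms, Finset.mem_union] at ha
  rcases ha with (ha | ha) | ha
  · simp only [genRule] at ha
    split_ifs at ha with hn
    · obtain ⟨b, hb, rfl⟩ := Finset.mem_image.1 ha
      subst hn
      exact (Finset.le_sup (f := Atm.vars) hb).trans hroot
    · rw [Finset.mem_singleton.1 ha, vars_tempAtm]
      exact Finset.inter_subset_left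
  · simp only [genRule, Finset.mem_union, Finset.mem_image, Finset.mem_filter] at ha
    rcases ha with (⟨b, ⟨-, hb⟩, rfl⟩ | ⟨m, ⟨-, rfl, -⟩, rfl⟩) | ⟨x, ⟨-, hx, -⟩, rfl⟩
    · exact hb
    · rw [vars_tempAtm]
      exact Finset.inter_subset_right
    · obtain ⟨b, -, hb, hxb⟩ := hx
      intro y hy
      obtain rfl : y = x := by simpa [Atm.vars, domAtm, mem_trmsVars, Trm.vars] using hy
      exact hb hxb
  · simp only [genRule, Finset.mem_image, Finset.mem_filter] at ha
    obtain ⟨b, ⟨-, hb⟩, rfl⟩ := ha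
    exact hb

/-- **Theorem (variables of generated rules).**
Every rule generated by lpopt from a rule `r` using a tree decomposition of
width `k` (all bags of size at most `k+1`) contains at most `k+1` distinct
variables; consequently, the number of its ground instances over a domain `C`
is at most `|C|^(k+1)`. -/
theorem lpopt_genRule_vars_and_grounding
    {P ι : Type} [DecidableEq P] [DecidableEq ι] [Fintype ι]
    (r : Rule P) (td : TreeDec ι (gaifman r) r.vars) (k : ℕ)
    (hroot : r.headVars ⊆ td.bag td.t.root)
    (hwidth : td.HasWidth k) :
    ∀ n : ι,
      ((genRule r td n).vars).card ≤ k + 1 ∧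
      ∀ C : Finset Cst, (groundInstances C (genRule r td n)).ncard ≤ C.card ^ (k + 1) := by
  intro n
  have hcard := (Finset.card_le_card (vars_genRule_subset_bag r td hroot n)).trans (hwidth n)
  exact ⟨hcard, fun C => ncard_groundInstances_le_of_card_vars_le C hcard⟩
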